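/- Let ω ∈ (−1,1) be a quadratic irrational and let E be the Even map, E(x) = |1/x| − 2⌊|1/x|/2 + 1/2⌋ (that is, |1/x| minus the even integer nearest to |1/x|). Then ω is purely periodic under E (i.e. E^[p](ω) = ω for some integer p ≥ 1) if and only if its Galois conjugate ω' satisfies ω' < −1. -/

import Mathlib

/-- The Even map `x ↦ |1/x| - 2⌊|1/x|/2 + 1/2⌋` (i.e. `|1/x|` minus the even integer
nearest to `|1/x|`) on irrationals, extended by `0` at the remaining points. -/
noncomputable def evenMap (x : ℝ) : ℝ :=
  open Classical in
  if Irrational x then |1 / x| - 2 * (⌊|1 / x| / 2 + 1 / 2⌋ : ℤ) else 0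

/-- the sign of `x` as an integer (`1` or `-1`) -/
noncomputable def eSgn (x : ℝ) : ℤ :=
  open Classical in
  if 0 < x then 1 else -1

/-- the digit -/
noncomputable def eDig (x : ℝ) : ℤ := ⌊|1 / x| / 2 + 1 / 2⌋

/-- natural extension of the Even map -/
noncomputable def eT (q : ℝ × ℝ) : ℝ × ℝ :=
  (evenMap q.1, (eSgn q.1 : ℝ) / q.2 - 2 * (eDig q.1 : ℝ))

/-- The second component is the conjugate of the quadratic irrational `x` of discriminant `D` -/
def eQ (D : ℤ) (q : ℝ × ℝ) : Prop :=
  Irrational q.1 ∧ -1 < q.1 ∧ q.1 < 1 ∧ ∃ a b c : ℤ, a ≠ 0 ∧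
    (a : ℝ) * q.1 ^ 2 + b * q.1 + c = 0 ∧ q.2 = -(b : ℝ) / a - q.1 ∧ b ^ 2 - 4 * a * c = D

theorem eSgn_cases (x : ℝ) (hx : x ≠ 0) :
    (0 < x ∧ eSgn x = 1) ∨ (x < 0 ∧ eSgn x = -1) := by
  unfold eSgn
  rcases lt_or_gt_of_ne hx with h | h
  · right; exact ⟨h, if_neg (not_lt.mpr h.le)⟩
  · left; exact ⟨h, if_pos h⟩

theorem evenMap_eq (x : ℝ) (hx : Irrational x) :
    evenMap x = (eSgn x : ℝ) / x - 2 * (eDig x : ℝ) := by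
  unfold evenMap eDig
  rw [if_pos hx]
  rcases eSgn_cases x hx.ne_zero with ⟨h, e⟩ | ⟨h, e⟩
  · rw [e, abs_of_pos (by positivity)]; simp
  · rw [e, abs_of_neg (one_div_neg.mpr h)]; push_cast; ring

theorem evenMap_irr (x : ℝ) (hx : Irrational x) : Irrational (evenMap x) := by
  rw [evenMap_eq x hx]
  have h2 : Irrational ((eSgn x : ℝ) / x) := by
    rcases eSgn_cases x hx.ne_zero with ⟨h, e⟩ | ⟨h, e⟩
    · rw [e]; simpa using hx.inv
    · rw [e]; simpa [neg_div] using hx.inv.neg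
  have := h2.sub_intCast (2 * eDig x)
  push_cast at this
  exact this

theorem evenMap_bd (x : ℝ) (hx : Irrational x) : -1 < evenMap x ∧ evenMap x < 1 := by
  have hi := evenMap_irr x hx
  have h1 : evenMap x ≠ -1 := by simpa using hi.ne_int (-1)
  have e : evenMap x = |1 / x| - 2 * (⌊|1 / x| / 2 + 1 / 2⌋ : ℤ) := by
    unfold evenMap; rw [if_pos hx]
  have f1 := Int.floor_le (|1 / x| / 2 + 1 / 2)
  have f2 := Int.lt_floor_add_one (|1 / x| / 2 + 1 / 2)
  refine ⟨lt_of_le_of_ne ?_ (Ne.symm h1), ?_⟩ <;> linarith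

theorem eDig_pos (x : ℝ) (hx : x ≠ 0) (h1 : -1 < x) (h2 : x < 1) : 1 ≤ eDig x := by
  unfold eDig
  rw [Int.le_floor]
  have h0 : 0 < |x| := abs_pos.mpr hx
  have : 1 < |1 / x| := by
    rw [abs_div, abs_one, lt_div_iff₀ h0, one_mul]
    exact abs_lt.mpr ⟨h1, h2⟩
  push_cast
  linarith

theorem conj_irr {x : ℝ} (hx : Irrational x) (a b : ℤ) : Irrational (-(b : ℝ) / a - x) := by
  have := hx.ratCast_sub (-(b : ℚ) / a)
  push_cast at this
  exact this

theorem eQ_irr {D : ℤ} {q : ℝ × ℝ} (h : eQ D q) : Irrational q.2 := by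
  obtain ⟨hx, -, -, a, b, c, -, -, h, -⟩ := h
  rw [h]; exact conj_irr hx a b

theorem eQ_step {D : ℤ} {q : ℝ × ℝ} (h : eQ D q) : eQ D (eT q) := by
  have hi' := eQ_irr h
  obtain ⟨hx, h1, h2, a, b, c, ha, hr, hc, hD⟩ := h
  obtain ⟨x, x'⟩ := q
  simp only at *
  have hx0 := hx.ne_zero
  have hx0' := hi'.ne_zero
  have haR : (a : ℝ) ≠ 0 := by exact_mod_cast ha
  have hs : (a : ℝ) * (x + x') = -b := by rw [hc]; field_simp; ring
  have hp : (a : ℝ) * (x * x') = c := by linear_combination x * hs - hr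
  have hc0 : (c : ℝ) ≠ 0 := by rw [← hp]; positivity
  refine ⟨evenMap_irr x hx, (evenMap_bd x hx).1, (evenMap_bd x hx).2,
    c, b * eSgn x + 4 * eDig x * c, a + 2 * eDig x * b * eSgn x + 4 * eDig x ^ 2 * c,
    by exact_mod_cast hc0, ?_, ?_, ?_⟩
  · simp only [eT]
    rw [evenMap_eq x hx]
    generalize eDig x = k
    rcases eSgn_cases x hx0 with ⟨h, e⟩ | ⟨h, e⟩ <;> rw [e] <;> push_cast <;> field_simp <;>
      linear_combination hr
  · simp only [eT]
    rw [evenMap_eq x hx]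
    generalize eDig x = k
    push_cast
    rw [← hp]
    have hb : (b : ℝ) = -(a * (x + x')) := by linarith
    rw [hb]
    field_simp
    ring
  · rw [← hD]
    generalize eDig x = k
    rcases eSgn_cases x hx0 with ⟨h, e⟩ | ⟨h, e⟩ <;> rw [e] <;> ring

theorem eQ_iter {D : ℤ} {q : ℝ × ℝ} (h : eQ D q) (n : ℕ) : eQ D (eT^[n] q) := by
  induction n with
  | zero => exact h
  | succ n ih => rw [Function.iterate_succ_apply']; exact eQ_step ih

theorem eT_fst (q : ℝ × ℝ) (n : ℕ) : (eT^[n] q).1 = evenMap^[n] q.1 := by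
  induction n with
  | zero => rfl
  | succ n ih => rw [Function.iterate_succ_apply', Function.iterate_succ_apply', ← ih]; rfl

theorem eQ_unique {D D' : ℤ} {x y z : ℝ} (h : eQ D (x, y)) (h' : eQ D' (x, z)) : y = z := by
  obtain ⟨hx, -, -, a, b, c, ha, hr, hc, -⟩ := h
  obtain ⟨-, -, -, a', b', c', ha', hr', hc', -⟩ := h'
  simp only at *
  have key : ((a' * b - a * b' : ℤ) : ℝ) * x = ((a * c' - a' * c : ℤ) : ℝ) := by
    push_cast; linear_combination a' * hr - a * hr'
  have h0 : a' * b - a * b' = 0 := by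
    by_contra hne
    exact (hx.intCast_mul hne).ne_int _ key
  have haR : (a : ℝ) ≠ 0 := by exact_mod_cast ha
  have haR' : (a' : ℝ) ≠ 0 := by exact_mod_cast ha'
  have h0R : (a' : ℝ) * b - a * b' = 0 := by exact_mod_cast h0
  rw [hc, hc']
  field_simp
  linear_combination -h0R

theorem sgn_div_bd (x x' : ℝ) (hx : x ≠ 0) (h : x' < -1) :
    -1 < (eSgn x : ℝ) / x' ∧ (eSgn x : ℝ) / x' < 1 := by
  have h1 : -1 < 1 / x' := by
    rw [lt_div_iff_of_neg (by linarith)]; linarith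
  have h2 : 1 / x' < 0 := one_div_neg.mpr (by linarith)
  rcases eSgn_cases x hx with ⟨-, e⟩ | ⟨-, e⟩ <;> rw [e] <;> push_cast
  · constructor <;> linarith
  · rw [neg_div]; constructor <;> linarith

theorem red_step {D : ℤ} {q : ℝ × ℝ} (h : eQ D q) (hq : q.2 < -1) : (eT q).2 < -1 := by
  obtain ⟨hx, h1, h2, -⟩ := h
  have hk : (1 : ℝ) ≤ eDig q.1 := by exact_mod_cast eDig_pos q.1 hx.ne_zero h1 h2
  have := (sgn_div_bd q.1 q.2 hx.ne_zero hq).2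
  simp only [eT]
  linarith

theorem eT_inj {D D' : ℤ} {q r : ℝ × ℝ} (h : eQ D q) (hq : q.2 < -1) (h' : eQ D' r)
    (hr : r.2 < -1) (e : eT q = eT r) : q = r := by
  obtain ⟨x, x'⟩ := q
  obtain ⟨z, z'⟩ := r
  have hx := h.1
  have hz := h'.1
  simp only [eT, Prod.mk.injEq] at *
  obtain ⟨e1, e2⟩ := e
  rw [evenMap_eq x hx, evenMap_eq z hz] at e1
  have b1 := sgn_div_bd x x' hx.ne_zero hq
  have b2 := sgn_div_bd z z' hz.ne_zero hr
  have hk : eDig x = eDig z := by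
    have l1 : (eDig x : ℝ) < eDig z + 1 := by linarith
    have l2 : (eDig z : ℝ) < eDig x + 1 := by linarith
    have l1' : eDig x < eDig z + 1 := by exact_mod_cast l1
    have l2' : eDig z < eDig x + 1 := by exact_mod_cast l2
    omega
  rw [hk] at e1 e2
  have e1' := sub_left_inj.mp e1
  have e2' := sub_left_inj.mp e2
  have n1 : x'⁻¹ < 0 := inv_lt_zero.mpr (by linarith)
  have n2 : z'⁻¹ < 0 := inv_lt_zero.mpr (by linarith)
  rcases eSgn_cases x hx.ne_zero with ⟨-, ex⟩ | ⟨-, ex⟩ <;>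
  rcases eSgn_cases z hz.ne_zero with ⟨-, ez⟩ | ⟨-, ez⟩ <;>
  rw [ex, ez] at e1' e2' <;> push_cast at e1' e2' <;>
  simp only [neg_div, one_div, neg_inj, inv_inj] at e1' e2'
  · exact ⟨e1', e2'⟩
  · linarith
  · linarith
  · exact ⟨e1', e2'⟩

theorem coef_bd (a b c D : ℤ) (hD : b ^ 2 - 4 * a * c = D) (h : (a + c) ^ 2 < b ^ 2) :
    |a| ≤ D ∧ |b| ≤ D ∧ |c| ≤ D := by
  have h1 : |a + c| < |b| := sq_lt_sq.mp h
  have h2 : |b| + |a + c| ≤ b ^ 2 - (a + c) ^ 2 := by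
    rw [← sq_abs b, ← sq_abs (a + c)]
    nlinarith [abs_nonneg b, abs_nonneg (a + c)]
  have h3 : |a - c| ≤ (a - c) ^ 2 := by
    rw [← sq_abs (a - c)]
    exact Int.le_self_sq _
  have h4 : b ^ 2 - (a + c) ^ 2 + (a - c) ^ 2 = D := by rw [← hD]; ring
  have hb : |b| ≤ D := by nlinarith [abs_nonneg (a + c), sq_nonneg (a - c)]
  have hs : |a + c| ≤ D := by linarith
  have hd : |a - c| ≤ D := by nlinarith [abs_nonneg (a + c), abs_nonneg b]
  rw [abs_le] at hs hd
  refine ⟨abs_le.mpr ?_, hb, abs_le.mpr ?_⟩ <;> constructor <;> linarith [hs.1, hs.2, hd.1, hd.2]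

theorem red_finite (D : ℤ) : {q : ℝ × ℝ | eQ D q ∧ q.2 < -1}.Finite := by
  let g : ℤ × ℤ × ℤ → ℝ × ℝ := fun t =>
    ((-(t.2.1 : ℝ) / t.1 + √(D : ℝ) / |(t.1 : ℝ)|) / 2,
     (-(t.2.1 : ℝ) / t.1 - √(D : ℝ) / |(t.1 : ℝ)|) / 2)
  have hf : ((Set.Icc (-D) D) ×ˢ ((Set.Icc (-D) D) ×ˢ (Set.Icc (-D) D)) :
      Set (ℤ × ℤ × ℤ)).Finite :=
    (Set.finite_Icc _ _).prod ((Set.finite_Icc _ _).prod (Set.finite_Icc _ _))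
  refine (hf.image g).subset ?_
  rintro ⟨x, x'⟩ ⟨⟨hx, h1, h2, a, b, c, ha, hr, hc, hD⟩, hq⟩
  simp only at *
  have haR : (a : ℝ) ≠ 0 := by exact_mod_cast ha
  have hs : (a : ℝ) * (x + x') = -b := by rw [hc]; field_simp; ring
  have hp : (a : ℝ) * (x * x') = c := by linear_combination x * hs - hr
  have hlt : (a + c) ^ 2 < b ^ 2 := by
    have ha2 : (0 : ℝ) < a ^ 2 := by positivity
    have e : (b : ℝ) ^ 2 - (a + c) ^ 2 = a ^ 2 * (((1 - x) * (1 - x')) * ((1 + x) * (-1 - x'))) := by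
      rw [← hp, show (b : ℝ) = -(a * (x + x')) by linarith]; ring
    have : (0 : ℝ) < a ^ 2 * (((1 - x) * (1 - x')) * ((1 + x) * (-1 - x'))) := by
      apply mul_pos ha2
      apply mul_pos <;> apply mul_pos <;> linarith
    have : ((a : ℝ) + c) ^ 2 < b ^ 2 := by linarith
    exact_mod_cast this
  obtain ⟨ba, bb, bc⟩ := coef_bd a b c D hD hlt
  refine ⟨(a, b, c), ⟨abs_le.mp ba, abs_le.mp bb, abs_le.mp bc⟩, ?_⟩
  have hDR : (D : ℝ) = (|(a : ℝ)| * (x - x')) ^ 2 := by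
    rw [← hD, mul_pow, sq_abs]; push_cast
    rw [← hp, show (b : ℝ) = -(a * (x + x')) by linarith]; ring
  have hsq : √(D : ℝ) / |(a : ℝ)| = x - x' := by
    rw [hDR, Real.sqrt_sq (mul_nonneg (abs_nonneg _) (by linarith))]
    have : |(a : ℝ)| ≠ 0 := abs_ne_zero.mpr haR
    field_simp
  simp only [g, Prod.mk.injEq]
  rw [hsq]
  constructor <;> linarith

theorem red_periodic {D : ℤ} {q : ℝ × ℝ} (h : eQ D q) (hq : q.2 < -1) :
    ∃ p : ℕ, 1 ≤ p ∧ eT^[p] q = q := by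
  let S := {q : ℝ × ℝ | eQ D q ∧ q.2 < -1}
  have hS : S.Finite := red_finite D
  have hm : ∀ n, eT^[n] q ∈ S := by
    intro n
    induction n with
    | zero => exact ⟨h, hq⟩
    | succ n ih =>
      rw [Function.iterate_succ_apply']
      exact ⟨eQ_step ih.1, red_step ih.1 ih.2⟩
  have hcancel : ∀ m d, eT^[m] (eT^[d] q) = eT^[m] q → eT^[d] q = q := by
    intro m d
    induction m with
    | zero => exact id
    | succ m ih =>
      intro e
      apply ih
      rw [Function.iterate_succ_apply', Function.iterate_succ_apply'] at e
      have k1 := hm (m + d)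
      rw [Function.iterate_add_apply] at k1
      exact eT_inj k1.1 k1.2 (hm m).1 (hm m).2 e
  obtain ⟨m, n, hmn, e⟩ := Set.Finite.exists_lt_map_eq_of_forall_mem hm hS
  refine ⟨n - m, by omega, hcancel m _ ?_⟩
  rw [← Function.iterate_add_apply, show m + (n - m) = n by omega]
  exact e.symm

theorem nonred_step {D : ℤ} {q : ℝ × ℝ} (h : eQ D q) (hne : q.1 ≠ q.2) (hq : -1 < q.2)
    (hq' : -1 < (eT q).2) : |q.1 - q.2| < |(eT q).1 - (eT q).2| := by
  have hi := eQ_irr h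
  obtain ⟨hx, h1, h2, -⟩ := h
  obtain ⟨x, x'⟩ := q
  have hk : (1 : ℝ) ≤ eDig x := by exact_mod_cast eDig_pos x hx.ne_zero h1 h2
  simp only [eT] at *
  rw [evenMap_eq x hx]
  have hx0 := hx.ne_zero
  have hx0' := hi.ne_zero
  have hb : 1 < (eSgn x : ℝ) / x' := by linarith
  have hlt : x' < 1 := by
    by_contra hge
    push Not at hge
    rcases eSgn_cases x hx0 with ⟨-, e⟩ | ⟨-, e⟩ <;> rw [e] at hb <;>
      rw [lt_div_iff₀ (by linarith)] at hb <;> push_cast at hb <;> linarith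
  have hd : (eSgn x : ℝ) / x - 2 * (eDig x : ℝ) - ((eSgn x : ℝ) / x' - 2 * (eDig x : ℝ))
      = -(eSgn x : ℝ) * (x - x') / (x * x') := by field_simp; ring
  have hs : |(-(eSgn x : ℝ))| = 1 := by
    rcases eSgn_cases x hx0 with ⟨-, e⟩ | ⟨-, e⟩ <;> rw [e] <;> simp
  rw [hd, abs_div, abs_mul, hs, one_mul]
  have hpos : 0 < |x - x'| := abs_pos.mpr (sub_ne_zero.mpr hne)
  have hpp : 0 < |x * x'| := abs_pos.mpr (mul_ne_zero hx0 hx0')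
  rw [lt_div_iff₀ hpp]
  have : |x * x'| < 1 := by
    rw [abs_mul]
    have a1 : |x| < 1 := abs_lt.mpr ⟨h1, h2⟩
    have a2 : |x'| < 1 := abs_lt.mpr ⟨hq, hlt⟩
    nlinarith [abs_nonneg x, abs_nonneg x']
  nlinarith

theorem eQ_ne {D : ℤ} {q : ℝ × ℝ} (h : eQ D q) : q.1 ≠ q.2 := by
  obtain ⟨hx, -, -, a, b, c, ha, hr, hc, hD⟩ := h
  intro e
  rw [hc] at e
  have haR : (a : ℝ) ≠ 0 := by exact_mod_cast ha
  field_simp at e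
  refine (hx.intCast_mul (m := 2 * a) (by omega)).ne_int (-b) ?_
  push_cast
  linarith

theorem periodic_red {D : ℤ} {q : ℝ × ℝ} (h : eQ D q) (p : ℕ) (hp : 1 ≤ p)
    (e : eT^[p] q = q) : q.2 < -1 := by
  by_contra hn
  have hprop : ∀ n m, (eT^[n] q).2 < -1 → (eT^[n + m] q).2 < -1 := by
    intro n m hlt
    induction m with
    | zero => exact hlt
    | succ m ih =>
      rw [← add_assoc, Function.iterate_succ_apply']
      exact red_step (eQ_iter h _) ih
  have hge : ∀ n, n ≤ p → -1 < (eT^[n] q).2 := by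
    intro n hnp
    by_contra hc
    have hne : (eT^[n] q).2 ≠ -1 := by simpa using (eQ_irr (eQ_iter h n)).ne_int (-1)
    have hlt := lt_of_le_of_ne (not_lt.mp hc) hne
    have := hprop n (p - n) hlt
    rw [show n + (p - n) = p by omega, e] at this
    exact hn this
  have hmono : ∀ n, n + 1 ≤ p → |q.1 - q.2| < |(eT^[n + 1] q).1 - (eT^[n + 1] q).2| := by
    intro n
    induction n with
    | zero =>
      intro h1
      exact nonred_step h (eQ_ne h) (hge 0 (by omega)) (hge 1 h1)
    | succ n ih =>
      intro h1
      refine (ih (by omega)).trans ?_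
      have k := hge (n + 1 + 1) h1
      rw [Function.iterate_succ_apply' eT (n + 1)] at k ⊢
      exact nonred_step (eQ_iter h _) (eQ_ne (eQ_iter h _)) (hge (n + 1) (by omega)) k
  have := hmono (p - 1) (by omega)
  rw [show p - 1 + 1 = p by omega, e] at this
  exact lt_irrefl _ this

/-- A quadratic irrational `ω ∈ (-1,1)` is purely periodic under the Even map iff its
Galois conjugate `ω' = -b/a - ω` satisfies `ω' < -1`. -/
theorem even_purely_periodic_iff
    (ω : ℝ) (hmem : ω ∈ Set.Ioo (-1 : ℝ) 1) (hirr : Irrational ω)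
    (a b c : ℤ) (ha : a ≠ 0)
    (hroot : (a : ℝ) * ω ^ 2 + (b : ℝ) * ω + (c : ℝ) = 0) :
    (∃ p : ℕ, 1 ≤ p ∧ evenMap^[p] ω = ω) ↔ -(b : ℝ) / (a : ℝ) - ω < -1 := by
  have hQ : eQ (b ^ 2 - 4 * a * c) (ω, -(b : ℝ) / (a : ℝ) - ω) :=
    ⟨hirr, hmem.1, hmem.2, a, b, c, ha, hroot, rfl, rfl⟩
  constructor
  · rintro ⟨p, hp, e⟩
    refine periodic_red hQ p hp ?_
    have h1 := eQ_iter hQ p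
    have h2 := eT_fst (ω, -(b : ℝ) / (a : ℝ) - ω) p
    rw [e] at h2
    refine Prod.ext h2 ?_
    generalize eT^[p] (ω, -(b : ℝ) / (a : ℝ) - ω) = r at h1 h2
    obtain ⟨r1, r2⟩ := r
    simp only at h2
    subst h2
    exact eQ_unique h1 hQ
  · intro h
    obtain ⟨p, hp, e⟩ := red_periodic hQ h
    refine ⟨p, hp, ?_⟩
    have h2 := eT_fst (ω, -(b : ℝ) / (a : ℝ) - ω) p
    rw [e] at h2
    exact h2.symm
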